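/- arXiv:0705.1663 — 3 statements merged into one kernel-verified Lean document; each statement's English description precedes it below -/
import Mathlib

section
/- For every biquadratic polynomial h(x₁,x₂) with complex coefficients, g₂(δ_{x₁}(h)) = g₂(δ_{x₂}(h)) and g₃(δ_{x₁}(h)) = g₃(δ_{x₂}(h)); here δ_{x₁}(h) is a polynomial of degree at most 4 in x₂ alone and δ_{x₂}(h) is a polynomial of degree at most 4 in x₁ alone. -/
open MvPolynomial

/-- `δ_{x_i}(h) = h_{x_i}^2 - 2 h h_{x_i x_i}` for a polynomial of two variables. -/
noncomputable def ds (i : Fin 2) (h : MvPolynomial (Fin 2) ℂ) : MvPolynomial (Fin 2) ℂ :=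
  (pderiv i h) ^ 2 - 2 * h * pderiv i (pderiv i h)

/-- The `k`-th coefficient of a polynomial `r` in the single variable `x_j`. -/
noncomputable def cf (j : Fin 2) (r : MvPolynomial (Fin 2) ℂ) (k : ℕ) : ℂ :=
  r.coeff (Finsupp.single j k)

/-- `g₂(r) = (12 r₀ r₄ - 3 r₁ r₃ + r₂²)/12` for a polynomial of degree at most 4
in the single variable `x_j`. -/
noncomputable def g2 (j : Fin 2) (r : MvPolynomial (Fin 2) ℂ) : ℂ :=
  (12 * cf j r 0 * cf j r 4 - 3 * cf j r 1 * cf j r 3 + (cf j r 2) ^ 2) / 12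

/-- `g₃(r) = (72 r₀ r₂ r₄ - 27 r₁² r₄ + 9 r₁ r₂ r₃ - 27 r₀ r₃² - 2 r₂³)/432` for a polynomial
of degree at most 4 in the single variable `x_j`. -/
noncomputable def g3 (j : Fin 2) (r : MvPolynomial (Fin 2) ℂ) : ℂ :=
  (72 * cf j r 0 * cf j r 2 * cf j r 4 - 27 * (cf j r 1) ^ 2 * cf j r 4
    + 9 * cf j r 1 * cf j r 2 * cf j r 3 - 27 * cf j r 0 * (cf j r 3) ^ 2
    - 2 * (cf j r 2) ^ 3) / 432

/-- A biquadratic polynomial is the sum of its nine monomials. -/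
lemma exists_eq_sum_of_degreeOf_le_two (h : MvPolynomial (Fin 2) ℂ) (hh : ∀ i, h.degreeOf i ≤ 2) :
    ∃ a : ℕ → ℕ → ℂ, h = ∑ i ∈ Finset.range 3, ∑ j ∈ Finset.range 3,
      C (a i j) * X 0 ^ i * X 1 ^ j := by
  refine ⟨fun i j => h.coeff (Finsupp.single 0 i + Finsupp.single 1 j), ?_⟩
  have hmon (c : ℂ) (i j : ℕ) : C c * X 0 ^ i * X 1 ^ j =
      monomial (Finsupp.single (0 : Fin 2) i + Finsupp.single 1 j) c := by
    simp [X_pow_eq_monomial, C_mul_monomial, monomial_mul]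
  have hsplit (m : Fin 2 →₀ ℕ) : m = Finsupp.single 0 (m 0) + Finsupp.single 1 (m 1) := by
    ext k; fin_cases k <;> simp
  have hiff (m : Fin 2 →₀ ℕ) (i j : ℕ) :
      Finsupp.single 0 i + Finsupp.single 1 j = m ↔ i = m 0 ∧ j = m 1 := by
    constructor
    · rintro rfl; simp
    · rintro ⟨rfl, rfl⟩; exact (hsplit m).symm
  ext m
  simp only [hmon, coeff_sum, coeff_monomial, hiff, ite_and]
  have hzero (hm : ¬ (m 0 < 3 ∧ m 1 < 3)) : h.coeff m = 0 := by
    by_contra hne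
    have hle (i : Fin 2) : m i ≤ 2 :=
      (monomial_le_degreeOf i (mem_support_iff.mpr hne)).trans (hh i)
    exact hm ⟨Nat.lt_succ_of_le (hle 0), Nat.lt_succ_of_le (hle 1)⟩
  by_cases h0 : m 0 < 3 <;> by_cases h1 : m 1 < 3 <;>
    simp [h0, h1, hzero, ← hsplit]

/-- On a quadratic in `x_i`, the operator `δ_{x_i}` is the discriminant. -/
lemma ds_quadratic (i : Fin 2) {p q r : MvPolynomial (Fin 2) ℂ} (hp : pderiv i p = 0)
    (hq : pderiv i q = 0) (hr : pderiv i r = 0) :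
    ds i (p + q * X i + r * X i ^ 2) = q ^ 2 - 4 * p * r := by
  have h2 : pderiv i (2 : MvPolynomial (Fin 2) ℂ) = 0 := by
    exact_mod_cast (pderiv i).map_natCast 2
  simp [ds, Derivation.leibniz, Derivation.leibniz_pow, hp, hq, hr, h2]
  ring

lemma cf_sum_range (j : Fin 2) (r : ℕ → ℂ) (n k : ℕ) :
    cf j (∑ l ∈ Finset.range n, C (r l) * X j ^ l) k = if k < n then r k else 0 := by
  simp [cf, coeff_sum, coeff_C_mul, coeff_X_pow, (Finsupp.single_injective j).eq_iff, eq_comm (b := k)]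

/-- The coefficients of the discriminant `q ^ 2 - 4 * p * r` of a quadratic whose coefficients
`p`, `q`, `r` are quadratics with coefficient sequences `p`, `q`, `r`. -/
def discrCoeff (p q r : ℕ → ℂ) : ℕ → ℂ
  | 0 => q 0 ^ 2 - 4 * p 0 * r 0
  | 1 => 2 * q 0 * q 1 - 4 * (p 0 * r 1 + p 1 * r 0)
  | 2 => 2 * q 0 * q 2 + q 1 ^ 2 - 4 * (p 0 * r 2 + p 1 * r 1 + p 2 * r 0)
  | 3 => 2 * q 1 * q 2 - 4 * (p 1 * r 2 + p 2 * r 1)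
  | 4 => q 2 ^ 2 - 4 * p 2 * r 2
  | _ => 0

lemma ds_eq_sum (a : ℕ → ℕ → ℂ) {i j : Fin 2} (hij : i ≠ j) :
    ds i (∑ k ∈ Finset.range 3, ∑ l ∈ Finset.range 3, C (a k l) * X i ^ k * X j ^ l) =
      ∑ l ∈ Finset.range 5, C (discrCoeff (a 0) (a 1) (a 2) l) * X j ^ l := by
  have hconst (b : ℕ → ℂ) :
      pderiv i (∑ l ∈ Finset.range 3, C (b l) * X j ^ l : MvPolynomial (Fin 2) ℂ) = 0 := by
    simp [Derivation.leibniz, Derivation.leibniz_pow, pderiv_X_of_ne hij.symm]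
  have hquad : (∑ k ∈ Finset.range 3, ∑ l ∈ Finset.range 3, C (a k l) * X i ^ k * X j ^ l :
      MvPolynomial (Fin 2) ℂ) = (∑ l ∈ Finset.range 3, C (a 0 l) * X j ^ l) +
        (∑ l ∈ Finset.range 3, C (a 1 l) * X j ^ l) * X i +
        (∑ l ∈ Finset.range 3, C (a 2 l) * X j ^ l) * X i ^ 2 := by
    simp only [Finset.sum_range_succ, Finset.sum_range_zero]
    ring
  have h4 : (C 4 : MvPolynomial (Fin 2) ℂ) = 4 := map_ofNat C 4
  have h2 : (C 2 : MvPolynomial (Fin 2) ℂ) = 2 := map_ofNat C 2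
  rw [hquad, ds_quadratic i (hconst _) (hconst _) (hconst _)]
  simp only [Finset.sum_range_succ, Finset.sum_range_zero, discrCoeff, map_add, map_sub, map_mul,
    map_pow, h2, h4]
  ring

/-- For a biquadratic `h(x₁,x₂)` (variables indexed `0,1`), the quartic polynomials
`δ_{x₁}(h)` (in `x₂` alone) and `δ_{x₂}(h)` (in `x₁` alone) have the same invariants
`g₂` and `g₃`. -/
theorem statement2 (h : MvPolynomial (Fin 2) ℂ) (hh : ∀ i, h.degreeOf i ≤ 2) :
    g2 1 (ds 0 h) = g2 0 (ds 1 h) ∧ g3 1 (ds 0 h) = g3 0 (ds 1 h) := by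
  obtain ⟨a, rfl⟩ := exists_eq_sum_of_degreeOf_le_two h hh
  have hswap : (∑ i ∈ Finset.range 3, ∑ j ∈ Finset.range 3, C (a i j) * X 0 ^ i * X 1 ^ j :
      MvPolynomial (Fin 2) ℂ) =
      ∑ j ∈ Finset.range 3, ∑ i ∈ Finset.range 3, C (a i j) * X 1 ^ j * X 0 ^ i := by
    rw [Finset.sum_comm]
    simp only [mul_right_comm]
  have h0 := ds_eq_sum a zero_ne_one
  have h1 := ds_eq_sum (fun j i => a i j) one_ne_zero
  rw [← hswap] at h1
  rw [h0, h1]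
  constructor
  · simp only [g2, cf_sum_range, Nat.reduceLT, if_true, discrCoeff]
    ring
  · simp only [g3, cf_sum_range, Nat.reduceLT, if_true, discrCoeff]
    ring
end

section
/- A biquadratic polynomial h(x,y) with complex coefficients satisfies δ_y(h) = x and δ_x(h) = y (as polynomials) if and only if there exists α ∈ ℂ, α ≠ 0, such that h(x,y) = (x−y)²/(4α) − (α/2)(x+y) + α³/4. -/
open MvPolynomial

/-- A polynomial in two variables of degree at most two in each variable is the sum of its nine
monomials. -/
theorem biquadratic_eq_sum {R : Type*} [CommSemiring R] (h : MvPolynomial (Fin 2) R)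
    (hh : ∀ i, h.degreeOf i ≤ 2) :
    ∃ a : ℕ → ℕ → R, h = ∑ i ∈ Finset.range 3, ∑ j ∈ Finset.range 3,
      C (a i j) * X 0 ^ i * X 1 ^ j := by
  classical
  let e : ℕ × ℕ → (Fin 2 →₀ ℕ) := fun p => Finsupp.single 0 p.1 + Finsupp.single 1 p.2
  have he : Function.Injective e := by
    rintro ⟨a, b⟩ ⟨c, d⟩ hp
    have h0 := DFunLike.congr_fun hp 0
    have h1 := DFunLike.congr_fun hp 1
    simp [e] at h0 h1
    simp [h0, h1]
  have hsub : h.support ⊆ (Finset.range 3 ×ˢ Finset.range 3).image e := by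
    intro m hm
    have hm0 := (degreeOf_le_iff.mp (hh 0)) m hm
    have hm1 := (degreeOf_le_iff.mp (hh 1)) m hm
    refine Finset.mem_image.mpr ⟨(m 0, m 1), ?_, ?_⟩
    · simp only [Finset.mem_product, Finset.mem_range]
      omega
    · ext i
      fin_cases i <;> simp [e]
  refine ⟨fun i j => h.coeff (e (i, j)), ?_⟩
  conv_lhs => rw [h.as_sum]
  rw [Finset.sum_subset hsub (fun m _ hm => by simp [notMem_support_iff.mp hm]),
    Finset.sum_image he.injOn, Finset.sum_product]
  refine Finset.sum_congr rfl fun i _ => Finset.sum_congr rfl fun j _ => ?_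
  simp only [e, X_pow_eq_monomial, C_mul_monomial, monomial_mul, mul_one]

/-- A polynomial function of degree at most four that vanishes identically has zero
coefficients. -/
theorem quartic_coeffs_eq_zero {c₀ c₁ c₂ c₃ c₄ : ℂ}
    (H : ∀ x : ℂ, c₄ * x ^ 4 + c₃ * x ^ 3 + c₂ * x ^ 2 + c₁ * x + c₀ = 0) :
    c₀ = 0 ∧ c₁ = 0 ∧ c₂ = 0 ∧ c₃ = 0 ∧ c₄ = 0 := by
  have e0 := H 0
  have e1 := H 1
  have e2 := H (-1)
  have e3 := H 2
  have e4 := H (-2)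
  refine ⟨?_, ?_, ?_, ?_, ?_⟩
  · linear_combination e0
  · linear_combination (2 / 3) * (e1 - e2) - (1 / 12) * (e3 - e4)
  · linear_combination (2 / 3) * (e1 + e2) - (1 / 24) * (e3 + e4) - (5 / 4) * e0
  · linear_combination (-1 / 6) * (e1 - e2) + (1 / 12) * (e3 - e4)
  · linear_combination (-1 / 6) * (e1 + e2) + (1 / 24) * (e3 + e4) + (1 / 4) * e0

/-- If the discriminant of `(a₂₂x² + a₁₂x + a₀₂)y² + (a₂₁x² + a₁₁x + a₀₁)y + (a₂₀x² + a₁₀x + a₀₀)`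
in `y` is `x`, its coefficients satisfy the expected equations. -/
theorem coeff_equations_of_discrim_eq {a b c d e f g k l : ℂ}
    (H : ∀ x : ℂ, (a * x ^ 2 + b * x + c) ^ 2
      - 4 * (d * x ^ 2 + e * x + f) * (g * x ^ 2 + k * x + l) = x) :
    c ^ 2 = 4 * f * l ∧ 2 * b * c - 4 * (e * l + f * k) = 1 ∧
      b ^ 2 + 2 * a * c = 4 * (d * l + e * k + f * g) ∧
      2 * a * b = 4 * (d * k + e * g) ∧ a ^ 2 = 4 * d * g := by
  obtain ⟨h0, h1, h2, h3, h4⟩ := quartic_coeffs_eq_zero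
    (c₀ := c ^ 2 - 4 * f * l) (c₁ := 2 * b * c - 4 * (e * l + f * k) - 1)
    (c₂ := b ^ 2 + 2 * a * c - 4 * (d * l + e * k + f * g))
    (c₃ := 2 * a * b - 4 * (d * k + e * g)) (c₄ := a ^ 2 - 4 * d * g)
    (fun x => by linear_combination H x)
  exact ⟨sub_eq_zero.mp h0, sub_eq_zero.mp h1, sub_eq_zero.mp h2, sub_eq_zero.mp h3,
    sub_eq_zero.mp h4⟩

/-- Solution of the coefficient equations expressing that the two discriminants of a biquadratic
polynomial with coefficients `aᵢⱼ` are `x` and `y`. -/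
theorem biquadratic_coeffs_of_discrims {a00 a01 a02 a10 a11 a12 a20 a21 a22 : ℂ}
    (p0 : a01 ^ 2 = 4 * a02 * a00) (p1 : 2 * a11 * a01 - 4 * (a12 * a00 + a02 * a10) = 1)
    (p2 : a11 ^ 2 + 2 * a21 * a01 = 4 * (a22 * a00 + a12 * a10 + a02 * a20))
    (p3 : 2 * a21 * a11 = 4 * (a22 * a10 + a12 * a20)) (p4 : a21 ^ 2 = 4 * a22 * a20)
    (q1 : 2 * a11 * a10 - 4 * (a21 * a00 + a20 * a01) = 1)
    (q0 : a10 ^ 2 = 4 * a20 * a00)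
    (q3 : 2 * a12 * a11 = 4 * (a22 * a01 + a21 * a02)) (q4 : a12 ^ 2 = 4 * a22 * a02) :
    ∃ α : ℂ, α ≠ 0 ∧ a22 = 0 ∧ a21 = 0 ∧ a12 = 0 ∧ a20 = 1 / (4 * α) ∧ a02 = 1 / (4 * α) ∧
      a11 = -2 * (1 / (4 * α)) ∧ a10 = -(α / 2) ∧ a01 = -(α / 2) ∧ a00 = α ^ 3 / 4 := by
  have h22 : a22 = 0 := by
    by_contra hk
    obtain ⟨t, rfl⟩ : ∃ t, a21 = 2 * a22 * t := ⟨a21 / (2 * a22), by field_simp⟩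
    obtain ⟨s, rfl⟩ : ∃ s, a12 = 2 * a22 * s := ⟨a12 / (2 * a22), by field_simp⟩
    obtain rfl : a20 = a22 * t ^ 2 :=
      mul_left_cancel₀ hk (by linear_combination (-1 / 4) * p4)
    obtain rfl : a02 = a22 * s ^ 2 :=
      mul_left_cancel₀ hk (by linear_combination (-1 / 4) * q4)
    obtain rfl : a10 = t * a11 - 2 * a22 * s * t ^ 2 :=
      mul_left_cancel₀ hk (by linear_combination (-1 / 4) * p3)
    obtain rfl : a01 = s * a11 - 2 * a22 * t * s ^ 2 :=
      mul_left_cancel₀ hk (by linear_combination (-1 / 4) * q3)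
    exact one_ne_zero (α := ℂ) (by linear_combination 2 * s * p2 - p1)
  subst h22
  obtain rfl : a21 = 0 := by simpa using p4
  obtain rfl : a12 = 0 := by simpa using q4
  have hm : a11 ≠ 0 := by
    rintro rfl
    have h : a02 * a20 = 0 := by linear_combination (-1 / 4) * p2
    rcases mul_eq_zero.mp h with rfl | rfl
    · simp at p1
    · simp at q1
  obtain rfl : a02 = -a11 / 2 := by
    linear_combination (-1 / 2) * a11 * p1 - a02 * q1 + a01 * p2
  obtain rfl : a20 = -a11 / 2 := by
    linear_combination (-1 / 2) * a11 * q1 - a20 * p1 + a10 * p2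
  have huv : 2 * a11 * (a01 + a10) = 1 := by linear_combination p1
  have hu : a01 = a10 := by
    linear_combination 2 * a11 * (p0 - q0) - (a01 - a10) * huv
  subst hu
  have hinv : a01 = 1 / (4 * a11) := by
    field_simp
    linear_combination huv
  subst hinv
  refine ⟨-1 / (2 * a11), by simp [hm], rfl, rfl, rfl, ?_, ?_, ?_, ?_, ?_, ?_⟩
  all_goals try first
    | (field_simp; done)
    | (field_simp; ring1)
  field_simp at p0 ⊢
  linear_combination (1 / 2) * p0

/-- A biquadratic `h(x,y)` satisfies `δ_y(h) = x`, `δ_x(h) = y` iff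
`h = (x-y)²/(4α) - (α/2)(x+y) + α³/4` for some `α ≠ 0`. -/
theorem statement13 (h : MvPolynomial (Fin 2) ℂ) (hh : ∀ i, h.degreeOf i ≤ 2) :
    (ds 1 h = X 0 ∧ ds 0 h = X 1) ↔
      ∃ α : ℂ, α ≠ 0 ∧
        h = C (1 / (4 * α)) * (X 0 - X 1) ^ 2 - C (α / 2) * (X 0 + X 1) + C (α ^ 3 / 4) := by
  constructor
  · rintro ⟨hy, hx⟩
    obtain ⟨a, rfl⟩ := biquadratic_eq_sum h hh
    have Hy : ∀ x : ℂ, (a 2 1 * x ^ 2 + a 1 1 * x + a 0 1) ^ 2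
        - 4 * (a 2 2 * x ^ 2 + a 1 2 * x + a 0 2) * (a 2 0 * x ^ 2 + a 1 0 * x + a 0 0) = x := by
      intro x
      have h := congrArg (eval ![x, 0]) hy
      simp [ds, Finset.sum_range_succ, pderiv_X] at h
      linear_combination h
    have Hx : ∀ y : ℂ, (a 1 2 * y ^ 2 + a 1 1 * y + a 1 0) ^ 2
        - 4 * (a 2 2 * y ^ 2 + a 2 1 * y + a 2 0) * (a 0 2 * y ^ 2 + a 0 1 * y + a 0 0) = y := by
      intro y
      have h := congrArg (eval ![0, y]) hx
      simp [ds, Finset.sum_range_succ, pderiv_X] at h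
      linear_combination h
    obtain ⟨p0, p1, p2, p3, p4⟩ := coeff_equations_of_discrim_eq Hy
    obtain ⟨q0, q1, -, q3, q4⟩ := coeff_equations_of_discrim_eq Hx
    obtain ⟨α, hα, h22, h21, h12, h20, h02, h11, h10, h01, h00⟩ :=
      biquadratic_coeffs_of_discrims p0 p1 p2 p3 p4 q1 q0 q3 q4
    refine ⟨α, hα, ?_⟩
    simp only [Finset.sum_range_succ, Finset.sum_range_zero, h22, h21, h12, h20, h02, h11, h10,
      h01, h00, C_mul, C_neg, C_0, map_ofNat]
    ring
  · rintro ⟨α, hα, rfl⟩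
    have h2 : ∀ i : Fin 2, pderiv i (2 : MvPolynomial (Fin 2) ℂ) = 0 :=
      fun i => (pderiv i).map_natCast 2
    constructor
    all_goals
      refine MvPolynomial.funext fun v => ?_
      simp [ds, pderiv_X, h2]
      field_simp
      ring
end

section
/- A biquadratic polynomial h(x,y) with complex coefficients satisfies δ_y(h) = x² and δ_x(h) = y² (as polynomials) if and only if there exist λ, μ, ν ∈ ℂ with μ² − 4λν = 1 such that either h(x,y) = λx² + μxy + νy² or h(x,y) = λx²y² + μxy + ν. -/
open MvPolynomial

/-- A polynomial in two variables of degree at most `2` in each of them is the sum of its nine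
possible terms. -/
theorem eq_sum_of_degreeOf_le_two {R : Type*} [CommSemiring R] (h : MvPolynomial (Fin 2) R)
    (hh : ∀ i, h.degreeOf i ≤ 2) :
    ∃ c : ℕ → ℕ → R, h = ∑ i ∈ Finset.range 3, ∑ j ∈ Finset.range 3,
      C (c i j) * (X 0 ^ i * X 1 ^ j) := by
  have key (i j : ℕ) (a : R) : C a * (X 0 ^ i * X 1 ^ j) =
      monomial (Finsupp.single (0 : Fin 2) i + Finsupp.single 1 j) a := by
    rw [X_pow_eq_monomial, X_pow_eq_monomial, monomial_mul, C_mul_monomial]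
    simp
  refine ⟨fun i j => coeff (Finsupp.single 0 i + Finsupp.single 1 j) h, ?_⟩
  ext m
  have hm (i j : ℕ) : Finsupp.single (0 : Fin 2) i + Finsupp.single 1 j = m ↔
      m 0 = i ∧ m 1 = j := by
    rw [Finsupp.ext_iff, Fin.forall_fin_two]
    simp [eq_comm]
  have hm' : Finsupp.single (0 : Fin 2) (m 0) + Finsupp.single 1 (m 1) = m :=
    (hm _ _).2 ⟨rfl, rfl⟩
  simp only [key, coeff_sum, coeff_monomial, hm, ite_and, Finset.sum_ite_eq,
    Finset.sum_ite_irrel, Finset.sum_const_zero, Finset.mem_range, hm']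
  by_cases h0 : coeff m h = 0
  · simp [h0]
  · have hle (i : Fin 2) : m i < 3 :=
      Nat.lt_succ_of_le ((monomial_le_degreeOf i (mem_support_iff.2 h0)).trans (hh i))
    simp [hle]

/-- The edge coefficient `u` of a biquadratic vanishes when its discriminants are pure squares. -/
theorem edge_coeff_eq_zero {K : Type*} [Field K] [CharZero K] {u t p q r s v w : K}
    (hu : u ^ 2 = 4 * p * q) (hv : v ^ 2 = 4 * q * r) (hw : w ^ 2 = 4 * p * s)
    (hut : u * t = 2 * (p * v + q * w))
    (ht : t ^ 2 = 4 * (p * r + q * s) + 2 * (v * w) + 1) : u = 0 := by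
  have : u ^ 2 = 0 := by
    linear_combination (u * t + 2 * (p * v + q * w)) * hut - u ^ 2 * ht
      - (4 * (p * r + q * s) + 2 * v * w) * hu + 4 * p ^ 2 * hv + 4 * q ^ 2 * hw
  simpa using this

/-- A polynomial function of degree at most `4` which is identically zero has zero coefficients. -/
theorem coeffs_eq_zero_of_quartic {K : Type*} [Field K] [CharZero K] {a b c d e : K}
    (h : ∀ x : K, a + b * x + c * x ^ 2 + d * x ^ 3 + e * x ^ 4 = 0) :
    a = 0 ∧ b = 0 ∧ c = 0 ∧ d = 0 ∧ e = 0 := by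
  have h0 := h 0
  have h1 := h 1
  have h2 := h (-1)
  have h3 := h 2
  have h4 := h (-2)
  refine ⟨?_, ?_, ?_, ?_, ?_⟩
  · linear_combination h0
  · linear_combination (2 / 3) * h1 - (2 / 3) * h2 - (1 / 12) * h3 + (1 / 12) * h4
  · linear_combination (-5 / 4) * h0 + (2 / 3) * h1 + (2 / 3) * h2 - (1 / 24) * h3 - (1 / 24) * h4
  · linear_combination (-1 / 6) * h1 + (1 / 6) * h2 + (1 / 12) * h3 - (1 / 12) * h4
  · linear_combination (1 / 4) * h0 - (1 / 6) * h1 - (1 / 6) * h2 + (1 / 24) * h3 + (1 / 24) * h4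

/-- A biquadratic `h(x,y)` satisfies `δ_y(h) = x²`, `δ_x(h) = y²` iff
`h = λx² + μxy + νy²` or `h = λx²y² + μxy + ν` for some `λ, μ, ν` with `μ² - 4λν = 1`. -/
theorem statement14 (h : MvPolynomial (Fin 2) ℂ) (hh : ∀ i, h.degreeOf i ≤ 2) :
    (ds 1 h = X 0 ^ 2 ∧ ds 0 h = X 1 ^ 2) ↔
      ∃ lam mu nu : ℂ, mu ^ 2 - 4 * lam * nu = 1 ∧
        (h = C lam * X 0 ^ 2 + C mu * (X 0 * X 1) + C nu * X 1 ^ 2 ∨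
         h = C lam * (X 0 ^ 2 * X 1 ^ 2) + C mu * (X 0 * X 1) + C nu) := by
  constructor
  · obtain ⟨c, hc⟩ := eq_sum_of_degreeOf_le_two h hh
    simp only [Finset.sum_range_succ, Finset.sum_range_zero, zero_add] at hc
    rintro ⟨hy, hx⟩
    have ey (x : ℂ) := congrArg (eval ![x, 0]) hy
    have ex (y : ℂ) := congrArg (eval ![0, y]) hx
    simp [ds, hc, pderiv_X] at ey ex
    obtain ⟨y0, y1, y2, y3, y4⟩ := coeffs_eq_zero_of_quartic
      (a := c 0 1 ^ 2 - 4 * c 0 0 * c 0 2)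
      (b := 2 * c 0 1 * c 1 1 - 4 * (c 0 0 * c 1 2 + c 1 0 * c 0 2))
      (c := 2 * c 0 1 * c 2 1 + c 1 1 ^ 2
        - 4 * (c 0 0 * c 2 2 + c 1 0 * c 1 2 + c 2 0 * c 0 2) - 1)
      (d := 2 * c 1 1 * c 2 1 - 4 * (c 1 0 * c 2 2 + c 2 0 * c 1 2))
      (e := c 2 1 ^ 2 - 4 * c 2 0 * c 2 2)
      (fun x => by linear_combination ey x)
    obtain ⟨x0, x1, x2, x3, x4⟩ := coeffs_eq_zero_of_quartic
      (a := c 1 0 ^ 2 - 4 * c 0 0 * c 2 0)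
      (b := 2 * c 1 0 * c 1 1 - 4 * (c 0 0 * c 2 1 + c 0 1 * c 2 0))
      (c := 2 * c 1 0 * c 1 2 + c 1 1 ^ 2
        - 4 * (c 0 0 * c 2 2 + c 0 1 * c 2 1 + c 0 2 * c 2 0) - 1)
      (d := 2 * c 1 1 * c 1 2 - 4 * (c 0 1 * c 2 2 + c 0 2 * c 2 1))
      (e := c 1 2 ^ 2 - 4 * c 0 2 * c 2 2)
      (fun y => by linear_combination ex y)
    have z01 : c 0 1 = 0 := edge_coeff_eq_zero (t := c 1 1) (p := c 0 2) (q := c 0 0)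
      (r := c 2 0) (s := c 2 2) (v := c 1 0) (w := c 1 2)
      (by linear_combination y0) (by linear_combination x0) (by linear_combination x4)
      (by linear_combination y1 / 2) (by linear_combination (x2 + 2 * y2) / 3)
    have z21 : c 2 1 = 0 := edge_coeff_eq_zero (t := c 1 1) (p := c 2 2) (q := c 2 0)
      (r := c 0 0) (s := c 0 2) (v := c 1 0) (w := c 1 2)
      (by linear_combination y4) (by linear_combination x0) (by linear_combination x4)
      (by linear_combination y3 / 2) (by linear_combination (x2 + 2 * y2) / 3)
    have z10 : c 1 0 = 0 := edge_coeff_eq_zero (t := c 1 1) (p := c 2 0) (q := c 0 0)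
      (r := c 0 2) (s := c 2 2) (v := c 0 1) (w := c 2 1)
      (by linear_combination x0) (by linear_combination y0) (by linear_combination y4)
      (by linear_combination x1 / 2) (by linear_combination (2 * x2 + y2) / 3)
    have z12 : c 1 2 = 0 := edge_coeff_eq_zero (t := c 1 1) (p := c 2 2) (q := c 0 2)
      (r := c 0 0) (s := c 2 0) (v := c 0 1) (w := c 2 1)
      (by linear_combination x4) (by linear_combination y0) (by linear_combination y4)
      (by linear_combination x3 / 2) (by linear_combination (2 * x2 + y2) / 3)
    simp only [z01, z10, z12, z21, ne_eq, OfNat.ofNat_ne_zero, not_false_eq_true, zero_pow, zero_sub,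
      neg_eq_zero, mul_eq_zero, false_or] at y0 y4 x0 x4
    rw [z01, z10] at y2
    simp only [z01, z10, z12, z21, C_0, zero_mul, pow_zero, pow_one, one_mul, mul_one, add_zero,
      zero_add] at hc
    by_cases diag : c 0 0 = 0 ∧ c 2 2 = 0
    · refine ⟨c 2 0, c 1 1, c 0 2, by linear_combination y2 + 4 * c 2 2 * diag.1, Or.inl ?_⟩
      rw [hc, diag.1, diag.2, C_0]
      ring
    · have anti : c 2 0 = 0 ∧ c 0 2 = 0 := by tauto
      refine ⟨c 2 2, c 1 1, c 0 0, by linear_combination y2 + 4 * c 0 2 * anti.1, Or.inr ?_⟩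
      rw [hc, anti.1, anti.2, C_0]
      ring
  · rintro ⟨l, m, n, hl, rfl | rfl⟩ <;>
    · have hC : (C m ^ 2 - 4 * C l * C n : MvPolynomial (Fin 2) ℂ) = 1 := by
        simpa [map_ofNat (C (σ := Fin 2) (R := ℂ)) 4] using congrArg (C (σ := Fin 2)) hl
      have h2 (i : Fin 2) : pderiv i (2 : MvPolynomial (Fin 2) ℂ) = 0 :=
        (pderiv i).map_natCast 2
      constructor
      · simp [ds, pderiv_X, h2]
        linear_combination X 0 ^ 2 * hC
      · simp [ds, pderiv_X, h2]
        linear_combination X 1 ^ 2 * hC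
end
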